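/- Let 0 < k < 2, q ≥ 2, M, B > 0, and let X be a standard d-dimensional Gaussian random vector. If f : ℝ^d → ℝ satisfies |f(x)| ≤ B·exp(M·|x|^k) for all x, then for every R > √2 + 1, E[|f(X) - f∘P_R(X)|^q] ≤ C₀ · (R-1)^{d-2} · exp(-(R-1)²/4), where C₀ = 2^q · (π/2)^{d/2 - 1} · B^q · exp(((2-k)/2)·q·M·(2qkM)^{k/(2-k)}) · (d+1)!! and P_R acts componentwise. -/

import Mathlib

open Real MeasureTheory ProbabilityTheory

/-- Double factorial. -/
def doubleFactorial : ℕ → ℕ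
  | 0 => 1
  | 1 => 1
  | (n + 2) => (n + 2) * doubleFactorial n

/-- The smoothed projection onto `[-R, R]`. -/
noncomputable def smoothProj (R x : ℝ) : ℝ :=
  if x ≤ -R then -R + 1/2
  else if x < -R + 1 then x^2/2 + R*x + (R-1)^2/2
  else if x ≤ R - 1 then x
  else if x < R then -x^2/2 + R*x - (R-1)^2/2
  else R - 1/2

/-- Euclidean norm on `Fin d → ℝ`. -/
noncomputable def euclNorm {d : ℕ} (x : Fin d → ℝ) : ℝ :=
  Real.sqrt (∑ i, (x i) ^ 2)

/-- The standard Gaussian measure on `Fin d → ℝ`. -/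
noncomputable def stdGaussian (d : ℕ) : Measure (Fin d → ℝ) :=
  Measure.pi fun _ => gaussianReal 0 1

lemma abs_smoothProj_le {R : ℝ} (hR : 1 ≤ R) (x : ℝ) : |smoothProj R x| ≤ |x| := by
  unfold smoothProj
  split_ifs with h₁ h₂ h₃ h₄
  · rw [abs_of_nonpos (by linarith), abs_of_nonpos (by linarith)]; linarith
  · rw [abs_of_nonpos (by linarith : x ≤ 0), abs_le]
    constructor <;> nlinarith [sq_nonneg (x + R - 1)]
  · exact le_rfl
  · rw [abs_of_nonneg (by linarith : 0 ≤ x), abs_le]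
    constructor <;> nlinarith [sq_nonneg (x - R + 1)]
  · rw [abs_of_nonneg (by linarith), abs_of_nonneg (by linarith)]; linarith

lemma smoothProj_eq_self {R x : ℝ} (hx : |x| ≤ R - 1) : smoothProj R x = x := by
  obtain ⟨h₁, h₂⟩ := abs_le.1 hx
  unfold smoothProj
  rw [if_neg (by linarith), if_neg (by linarith), if_pos h₂]

lemma euclNorm_nonneg {d : ℕ} (x : Fin d → ℝ) : 0 ≤ euclNorm x := Real.sqrt_nonneg _

lemma sq_euclNorm {d : ℕ} (x : Fin d → ℝ) : euclNorm x ^ 2 = ∑ i, x i ^ 2 :=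
  Real.sq_sqrt (Finset.sum_nonneg fun i _ => sq_nonneg (x i))

lemma abs_le_euclNorm {d : ℕ} (x : Fin d → ℝ) (i : Fin d) : |x i| ≤ euclNorm x :=
  Real.abs_le_sqrt
    (Finset.single_le_sum (f := fun i => x i ^ 2) (fun j _ => sq_nonneg (x j)) (Finset.mem_univ i))

lemma euclNorm_mono {d : ℕ} {x y : Fin d → ℝ} (h : ∀ i, |x i| ≤ |y i|) :
    euclNorm x ≤ euclNorm y :=
  Real.sqrt_le_sqrt (Finset.sum_le_sum fun i _ => sq_le_sq.2 (h i))

lemma euclNorm_eq_norm {d : ℕ} (x : EuclideanSpace ℝ (Fin d)) : euclNorm (WithLp.ofLp x) = ‖x‖ := by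
  simp [euclNorm, EuclideanSpace.norm_eq]

/-- Weighted AM-GM, absorbing a subquadratic power into `t ^ 2 / 4`. -/
lemma mul_rpow_le_sq_div_four_add {k q M t : ℝ} (hk0 : 0 < k) (hk2 : k < 2) (hq : 0 < q)
    (hM : 0 < M) (ht : 0 ≤ t) :
    q * M * t ^ k ≤ t ^ 2 / 4 + ((2 - k) / 2) * q * M * (2 * q * k * M) ^ (k / (2 - k)) := by
  have hA : 0 < 2 * q * k * M := by positivity
  have hk : 0 < 2 - k := by linarith
  set s := (2 * q * k * M) ^ (1 / (2 - k)) with hs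
  have hs0 : 0 < s := by positivity
  have h₁ : s ^ (2 - k) = 2 * q * k * M := by
    rw [hs, ← Real.rpow_mul hA.le, one_div_mul_cancel hk.ne', Real.rpow_one]
  have h₂ : s ^ k = (2 * q * k * M) ^ (k / (2 - k)) := by
    rw [hs, ← Real.rpow_mul hA.le]; congr 1; ring
  have h₃ : s ^ 2 = 2 * q * k * M * s ^ k := by
    rw [← h₁, ← Real.rpow_add hs0, ← Real.rpow_natCast]; congr 1; push_cast; ring
  have h := Real.geom_mean_le_arith_mean2_weighted (w₁ := k / 2) (w₂ := (2 - k) / 2)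
    (p₁ := t ^ 2) (p₂ := s ^ 2) (by positivity) (by positivity) (by positivity) (by positivity)
    (by ring)
  rw [← Real.rpow_natCast t, ← Real.rpow_natCast s, ← Real.rpow_mul ht, ← Real.rpow_mul hs0.le,
    show ((2 : ℕ) : ℝ) * (k / 2) = k by push_cast; ring,
    show ((2 : ℕ) : ℝ) * ((2 - k) / 2) = 2 - k by push_cast; ring, h₁, Real.rpow_natCast,
    Real.rpow_natCast, h₃] at h
  rw [← h₂]
  have h₄ : k * (q * M * t ^ k) ≤ k * (t ^ 2 / 4 + ((2 - k) / 2) * q * M * s ^ k) := by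
    nlinarith
  exact le_of_mul_le_mul_left h₄ hk0

/-- The tail moments `∫_r^∞ t ^ n exp (-t² / 4) dt`. -/
noncomputable def gaussTail (r : ℝ) (n : ℕ) : ℝ :=
  ∫ t in Set.Ioi r, t ^ n * Real.exp (-t ^ 2 / 4)

lemma integrable_pow_mul_exp_neg_sq_div_four (n : ℕ) :
    Integrable fun t : ℝ => t ^ n * Real.exp (-t ^ 2 / 4) := by
  have h := integrable_rpow_mul_exp_neg_mul_sq (b := 1 / 4) (by norm_num) (s := n)
    (by have : (0 : ℝ) ≤ n := n.cast_nonneg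
        linarith)
  refine h.congr (ae_of_all _ fun t => ?_)
  simp only [Real.rpow_natCast]
  congr 2; ring

lemma hasDerivAt_exp_neg_sq_div_four (t : ℝ) :
    HasDerivAt (fun t : ℝ => Real.exp (-t ^ 2 / 4)) (-(t / 2) * Real.exp (-t ^ 2 / 4)) t := by
  have h := (((hasDerivAt_pow 2 t).neg).div_const 4).exp
  convert! h using 1
  simp only [Pi.neg_apply]
  push_cast; ring

lemma tendsto_pow_mul_exp_neg_sq_div_four (n : ℕ) :
    Filter.Tendsto (fun t : ℝ => t ^ n * Real.exp (-t ^ 2 / 4)) Filter.atTop (nhds 0) := by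
  have h := (rpow_mul_exp_neg_mul_sq_isLittleO_exp_neg (b := 1 / 4) (by norm_num) n).trans_tendsto
    (show Filter.Tendsto (fun x : ℝ => Real.exp (-(1 / 2) * x)) Filter.atTop (nhds 0) from
      Real.tendsto_exp_atBot.comp (Filter.tendsto_id.const_mul_atTop_of_neg (by norm_num)))
  refine h.congr fun t => ?_
  simp only [Real.rpow_natCast]
  congr 2; ring

lemma gaussTail_one (r : ℝ) : gaussTail r 1 = 2 * Real.exp (-r ^ 2 / 4) := by
  have h := integral_Ioi_of_hasDerivAt_of_tendsto' (a := r) (m := 0)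
    (f := fun t => (-2) * Real.exp (-t ^ 2 / 4)) (f' := fun t => t ^ 1 * Real.exp (-t ^ 2 / 4))
    (fun t _ => by
      convert! (hasDerivAt_exp_neg_sq_div_four t).const_mul (-2) using 1
      ring)
    (integrable_pow_mul_exp_neg_sq_div_four 1).integrableOn
    (by simpa using (tendsto_pow_mul_exp_neg_sq_div_four 0).const_mul (-2))
  rw [gaussTail, h]; ring

lemma gaussTail_add_two (r : ℝ) (n : ℕ) :
    gaussTail r (n + 2) = 2 * r ^ (n + 1) * Real.exp (-r ^ 2 / 4) + 2 * (n + 1) * gaussTail r n := by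
  have hi (m : ℕ) := (integrable_pow_mul_exp_neg_sq_div_four m).integrableOn (s := Set.Ioi r)
  have h := integral_Ioi_of_hasDerivAt_of_tendsto' (a := r) (m := 0)
    (f := fun t => (-2) * (t ^ (n + 1) * Real.exp (-t ^ 2 / 4)))
    (f' := fun t => t ^ (n + 2) * Real.exp (-t ^ 2 / 4)
      - 2 * (n + 1) * (t ^ n * Real.exp (-t ^ 2 / 4)))
    (fun t _ => by
      convert! (((hasDerivAt_pow (n + 1) t).mul (hasDerivAt_exp_neg_sq_div_four t)).const_mul (-2))
        using 1
      simp only [Nat.add_sub_cancel]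
      push_cast; ring)
    ((hi (n + 2)).sub ((hi n).const_mul _))
    (by simpa using (tendsto_pow_mul_exp_neg_sq_div_four (n + 1)).const_mul (-2))
  rw [integral_sub (hi (n + 2)) ((hi n).const_mul _), integral_const_mul] at h
  unfold gaussTail
  linarith

lemma gaussTail_zero_le {r : ℝ} (hr : 0 < r) :
    gaussTail r 0 ≤ 2 / r * Real.exp (-r ^ 2 / 4) := by
  have hi (m : ℕ) := (integrable_pow_mul_exp_neg_sq_div_four m).integrableOn (s := Set.Ioi r)
  have h : gaussTail r 0 ≤ ∫ t in Set.Ioi r, r⁻¹ * (t ^ 1 * Real.exp (-t ^ 2 / 4)) := by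
    refine setIntegral_mono_on (hi 0) ((hi 1).const_mul _) measurableSet_Ioi fun t ht => ?_
    rw [← mul_assoc]
    refine mul_le_mul_of_nonneg_right ?_ (Real.exp_pos _).le
    rw [pow_zero, pow_one, inv_mul_eq_div, one_le_div hr]
    exact (Set.mem_Ioi.1 ht).le
  rw [integral_const_mul] at h
  refine h.trans_eq ?_
  have := gaussTail_one r
  unfold gaussTail at this
  rw [this]; ring

/-- The normalised surface area: for `n = d - 1`, the integral against the standard Gaussian of a
radial function `φ(|x|)` equals this constant times `∫ t ^ n φ(t) exp (-t² / 2) dt`. -/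
noncomputable def gaussSurface (n : ℕ) : ℝ :=
  (n + 1) * (√2)⁻¹ ^ (n + 1) / Real.Gamma (((n + 1 : ℕ) : ℝ) / 2 + 1)

lemma gaussSurface_zero : gaussSurface 0 = √2 / √π := by
  have h := Real.Gamma_add_one (s := 1 / 2) (by norm_num)
  rw [Real.Gamma_one_half_eq] at h
  have h2 : √2 * √2 = 2 := Real.mul_self_sqrt (by norm_num)
  have : √π ≠ 0 := by positivity
  have : √2 ≠ 0 := by positivity
  rw [gaussSurface]
  norm_num at h ⊢
  rw [h]
  field_simp
  linarith

lemma gaussSurface_one : gaussSurface 1 = 1 := by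
  norm_num [gaussSurface, Real.Gamma_two]

lemma gaussSurface_pos (n : ℕ) : 0 < gaussSurface n := by
  have := Real.Gamma_pos_of_pos (s := ((n + 1 : ℕ) : ℝ) / 2 + 1) (by positivity)
  unfold gaussSurface; positivity

lemma gaussSurface_add_two (n : ℕ) : gaussSurface (n + 2) * (n + 1) = gaussSurface n := by
  have h2 : √2 ^ 2 = 2 := Real.sq_sqrt (by norm_num)
  have hΓ := Real.Gamma_pos_of_pos (s := ((n + 1 : ℕ) : ℝ) / 2 + 1) (by positivity)
  have h := Real.Gamma_add_one (s := ((n + 1 : ℕ) : ℝ) / 2 + 1) (by positivity)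
  have e : ((n + 2 + 1 : ℕ) : ℝ) / 2 + 1 = ((n + 1 : ℕ) : ℝ) / 2 + 1 + 1 := by push_cast; ring
  unfold gaussSurface
  rw [e, h, show (√2)⁻¹ ^ (n + 2 + 1) = (√2)⁻¹ ^ (n + 1) * (√2 ^ 2)⁻¹ by ring, h2]
  have : (n : ℝ) + 1 ≠ 0 := by positivity
  push_cast at hΓ ⊢
  field_simp
  ring

/-- The dimensional constant `(π / 2) ^ (d / 2 - 1) (d + 1)!!` for `d = n + 1`. -/
noncomputable def dimConst (n : ℕ) : ℝ :=
  (π / 2) ^ (((n + 1 : ℕ) : ℝ) / 2 - 1) * (doubleFactorial (n + 2) : ℝ)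

lemma dimConst_zero : dimConst 0 = 2 * (√2 / √π) := by
  have : (π / 2) ^ (((0 + 1 : ℕ) : ℝ) / 2 - 1) = √2 / √π := by
    rw [show (((0 + 1 : ℕ) : ℝ) / 2 - 1) = -(1 / 2) by norm_num, Real.rpow_neg (by positivity),
      ← Real.sqrt_eq_rpow, Real.sqrt_div Real.pi_pos.le, inv_div]
  rw [dimConst, this]
  norm_num [doubleFactorial]
  ring

lemma dimConst_one : dimConst 1 = 3 := by
  norm_num [dimConst, doubleFactorial]

lemma dimConst_add_two (n : ℕ) : dimConst (n + 2) = (π / 2) * (n + 4) * dimConst n := by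
  unfold dimConst
  rw [show ((n + 2 + 1 : ℕ) : ℝ) / 2 - 1 = 1 + (((n + 1 : ℕ) : ℝ) / 2 - 1) by push_cast; ring,
    Real.rpow_add (by positivity), Real.rpow_one, doubleFactorial]
  push_cast; ring

lemma two_mul_gaussSurface_le (n : ℕ) : 2 * gaussSurface n ≤ dimConst n := by
  induction n using Nat.twoStepInduction with
  | zero => rw [gaussSurface_zero, dimConst_zero]
  | one => rw [gaussSurface_one, dimConst_one]; norm_num
  | more n ih _ =>
    have hK := gaussSurface_pos n
    have hK2 := gaussSurface_pos (n + 2)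
    have hn : (0 : ℝ) ≤ n := n.cast_nonneg
    have h₁ : gaussSurface (n + 2) ≤ gaussSurface n := by
      rw [← gaussSurface_add_two n]; nlinarith
    have h₂ : 1 ≤ π / 2 * (n + 4) := by nlinarith [Real.pi_gt_three]
    rw [dimConst_add_two]
    nlinarith

lemma gaussSurface_mul_gaussTail_le {r : ℝ} (hr : √2 < r) (n : ℕ) :
    gaussSurface n * gaussTail r n ≤
      dimConst n * r ^ (((n + 1 : ℕ) : ℝ) - 2) * Real.exp (-r ^ 2 / 4) := by
  have hr0 : 0 < r := (Real.sqrt_nonneg 2).trans_lt hr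
  have hr2 : 2 < r ^ 2 := (Real.sqrt_lt' hr0).1 hr
  have hE := Real.exp_pos (-r ^ 2 / 4)
  induction n using Nat.twoStepInduction with
  | zero =>
    refine (mul_le_mul_of_nonneg_left (gaussTail_zero_le hr0) (gaussSurface_pos 0).le).trans_eq ?_
    rw [gaussSurface_zero, dimConst_zero,
      show (((0 + 1 : ℕ) : ℝ) - 2) = -1 by norm_num, Real.rpow_neg_one]
    ring
  | one =>
    rw [gaussSurface_one, dimConst_one, gaussTail_one]
    norm_num
    linarith
  | more n ih _ =>
    set E := Real.exp (-r ^ 2 / 4)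
    have hn : (0 : ℝ) ≤ n := n.cast_nonneg
    have hK := gaussSurface_pos n
    have hK2 := gaussSurface_pos (n + 2)
    have hKD := two_mul_gaussSurface_le n
    have h₁ : gaussSurface (n + 2) ≤ gaussSurface n := by
      rw [← gaussSurface_add_two n]; nlinarith
    have hp : r ^ (((n + 1 : ℕ) : ℝ) - 2) * r ^ 2 = r ^ (n + 1) := by
      rw [← Real.rpow_natCast r 2, ← Real.rpow_add hr0, ← Real.rpow_natCast]
      congr 1; push_cast; ring
    have hp' : r ^ (((n + 2 + 1 : ℕ) : ℝ) - 2) = r ^ (n + 1) := by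
      rw [← Real.rpow_natCast]
      congr 1; push_cast; ring
    have hs := Real.rpow_pos_of_pos hr0 (((n + 1 : ℕ) : ℝ) - 2)
    rw [hp', gaussTail_add_two, dimConst_add_two]
    set s := r ^ (((n + 1 : ℕ) : ℝ) - 2)
    have hP : 0 < r ^ (n + 1) * E := by positivity
    have h₂ : 2 * (dimConst n * s * E) ≤ dimConst n * (r ^ (n + 1) * E) := by
      rw [← hp]
      have : 0 ≤ dimConst n * s * E := by
        have : 0 ≤ dimConst n := by linarith
        positivity
      nlinarith
    calc gaussSurface (n + 2) * (2 * r ^ (n + 1) * E + 2 * (n + 1) * gaussTail r n)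
        = 2 * gaussSurface (n + 2) * (r ^ (n + 1) * E)
          + 2 * ((gaussSurface (n + 2) * (n + 1)) * gaussTail r n) := by ring
      _ ≤ dimConst n * (r ^ (n + 1) * E) + dimConst n * (r ^ (n + 1) * E) := by
        rw [gaussSurface_add_two]
        refine add_le_add (mul_le_mul_of_nonneg_right (by linarith) hP.le) ?_
        linarith
      _ = 2 * (dimConst n * (r ^ (n + 1) * E)) := by ring
      _ ≤ π / 2 * (n + 4) * (dimConst n * (r ^ (n + 1) * E)) := by
        refine mul_le_mul_of_nonneg_right (by nlinarith [Real.pi_gt_three]) ?_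
        exact mul_nonneg (by linarith) hP.le
      _ = _ := by ring

lemma pi_gaussianReal_eq_withDensity (d : ℕ) :
    _root_.stdGaussian d =
      volume.withDensity fun x => ENNReal.ofReal (∏ i, gaussianPDFReal 0 1 (x i)) := by
  refine Measure.pi_eq fun s hs => ?_
  have hint (i : Fin d) : Integrable (gaussianPDFReal 0 1) (volume.restrict (s i)) :=
    (integrable_gaussianPDFReal 0 1).integrableOn
  rw [withDensity_apply _ (MeasurableSet.univ_pi hs), volume_pi, Measure.restrict_pi_pi,
    ← ofReal_integral_eq_lintegral_ofReal
      (Integrable.fintype_prod_dep (f := fun _ => gaussianPDFReal 0 1) hint)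
      (ae_of_all _ fun x => Finset.prod_nonneg fun i _ => gaussianPDFReal_nonneg 0 1 (x i)),
    integral_fintype_prod_eq_prod (fun _ => gaussianPDFReal 0 1),
    ENNReal.ofReal_prod_of_nonneg fun i _ => integral_nonneg (gaussianPDFReal_nonneg 0 1)]
  refine Finset.prod_congr rfl fun i _ => ?_
  rw [gaussianReal_apply_eq_integral _ one_ne_zero]

lemma prod_gaussianPDFReal {d : ℕ} (x : Fin d → ℝ) :
    ∏ i, gaussianPDFReal 0 1 (x i) = (√(2 * π))⁻¹ ^ d * Real.exp (-euclNorm x ^ 2 / 2) := by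
  simp only [gaussianPDFReal, Finset.prod_mul_distrib, ← Real.exp_sum, sq_euclNorm]
  simp [← Finset.sum_div, Finset.sum_neg_distrib]

/-- The Gaussian weight outside the ball of radius `r`. -/
noncomputable def tailWeight (r : ℝ) : ℝ → ℝ :=
  (Set.Ioi r).indicator fun t => Real.exp (-t ^ 2 / 4)

lemma pow_smul_tailWeight (r : ℝ) (n : ℕ) :
    (fun t : ℝ => t ^ n • tailWeight r t) =
      (Set.Ioi r).indicator fun t => t ^ n * Real.exp (-t ^ 2 / 4) := by
  ext t
  by_cases ht : t ∈ Set.Ioi r <;> simp [tailWeight, ht]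

lemma integrable_tailWeight_euclNorm (r : ℝ) (n : ℕ) :
    Integrable fun x : Fin (n + 1) → ℝ => tailWeight r (euclNorm x) := by
  rw [← (PiLp.volume_preserving_ofLp (Fin (n + 1))).integrable_comp_emb
    (MeasurableEquiv.toLp 2 _).symm.measurableEmbedding]
  have := (integrable_fun_norm_addHaar (E := EuclideanSpace ℝ (Fin (n + 1))) volume
    (f := tailWeight r)).2 (by
      rw [pow_smul_tailWeight]
      exact ((integrable_pow_mul_exp_neg_sq_div_four _).indicator measurableSet_Ioi).integrableOn)
  refine this.congr (ae_of_all _ fun x => ?_)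
  simp [← euclNorm_eq_norm]

lemma integral_tailWeight_euclNorm {r : ℝ} (hr : 0 ≤ r) (n : ℕ) :
    ∫ x : Fin (n + 1) → ℝ, tailWeight r (euclNorm x) =
      √(2 * π) ^ (n + 1) * (gaussSurface n * gaussTail r n) := by
  rw [← (PiLp.volume_preserving_ofLp (Fin (n + 1))).integral_comp
    (MeasurableEquiv.toLp 2 _).symm.measurableEmbedding]
  have h := integral_fun_norm_addHaar (E := EuclideanSpace ℝ (Fin (n + 1))) volume
    (f := tailWeight r)
  rw [pow_smul_tailWeight, setIntegral_indicator measurableSet_Ioi,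
    Set.inter_eq_right.2 (Set.Ioi_subset_Ioi hr)] at h
  have hΓ := Real.Gamma_pos_of_pos (s := ((n + 1 : ℕ) : ℝ) / 2 + 1) (by positivity)
  have hv : (volume : Measure (EuclideanSpace ℝ (Fin (n + 1)))).real (Metric.ball 0 1) =
      √π ^ (n + 1) / Real.Gamma (((n + 1 : ℕ) : ℝ) / 2 + 1) := by
    rw [Measure.real, EuclideanSpace.volume_ball]
    simp only [Fintype.card_fin, ENNReal.ofReal_one, one_pow, one_mul]
    exact ENNReal.toReal_ofReal (by positivity)
  rw [hv, finrank_euclideanSpace_fin, Nat.add_sub_cancel] at h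
  calc _ = ∫ x : EuclideanSpace ℝ (Fin (n + 1)), tailWeight r ‖x‖ := by
        refine integral_congr_ae (ae_of_all _ fun x => ?_)
        simp [← euclNorm_eq_norm]
    _ = _ := by
        rw [h, gaussSurface, gaussTail, Real.sqrt_mul (by norm_num), mul_pow, inv_pow]
        simp only [nsmul_eq_mul, smul_eq_mul]
        push_cast
        field_simp

lemma tailWeight_nonneg (r t : ℝ) : 0 ≤ tailWeight r t :=
  Set.indicator_nonneg (fun _ _ => (Real.exp_pos _).le) _

lemma abs_sub_comp_smoothProj_rpow_le {d : ℕ} {k q M B R : ℝ} (hk0 : 0 < k) (hk2 : k < 2)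
    (hq : 0 < q) (hM : 0 < M) (hB : 0 < B) (hR : 1 ≤ R) {f : (Fin d → ℝ) → ℝ}
    (hf : ∀ x, |f x| ≤ B * Real.exp (M * euclNorm x ^ k)) (x : Fin d → ℝ) :
    |f x - f (fun i => smoothProj R (x i))| ^ q * Real.exp (-euclNorm x ^ 2 / 2) ≤
      2 ^ q * B ^ q * Real.exp (((2 - k) / 2) * q * M * (2 * q * k * M) ^ (k / (2 - k))) *
        tailWeight (R - 1) (euclNorm x) := by
  by_cases hx : R - 1 < euclNorm x
  · have ht := euclNorm_nonneg x
    have h₁ : |f x - f (fun i => smoothProj R (x i))| ≤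
        2 * B * Real.exp (M * euclNorm x ^ k) := by
      have h := (hf fun i => smoothProj R (x i)).trans
        (mul_le_mul_of_nonneg_left (Real.exp_le_exp.2 (mul_le_mul_of_nonneg_left
          (Real.rpow_le_rpow (euclNorm_nonneg _)
            (euclNorm_mono fun i => abs_smoothProj_le hR (x i)) hk0.le) hM.le)) hB.le)
      have := abs_sub (f x) (f fun i => smoothProj R (x i))
      linarith [hf x]
    have h₂ := Real.rpow_le_rpow (abs_nonneg _) h₁ hq.le
    rw [Real.mul_rpow (by positivity) (Real.exp_pos _).le, Real.mul_rpow (by norm_num) hB.le,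
      ← Real.exp_mul] at h₂
    rw [tailWeight, Set.indicator_of_mem (Set.mem_Ioi.2 hx)]
    refine (mul_le_mul_of_nonneg_right h₂ (Real.exp_pos _).le).trans ?_
    rw [mul_assoc, ← Real.exp_add, mul_assoc _ (Real.exp _), ← Real.exp_add]
    refine mul_le_mul_of_nonneg_left (Real.exp_le_exp.2 ?_) (by positivity)
    have := mul_rpow_le_sq_div_four_add hk0 hk2 hq hM ht
    linarith
  · have h : (fun i => smoothProj R (x i)) = x := funext fun i =>
      smoothProj_eq_self ((abs_le_euclNorm x i).trans (not_lt.1 hx))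
    rw [h, sub_self, abs_zero, Real.zero_rpow hq.ne', zero_mul]
    exact mul_nonneg (by positivity) (tailWeight_nonneg _ _)

theorem projection_error_bound (d : ℕ) (hd : 1 ≤ d) (k q M B R : ℝ)
    (hk0 : 0 < k) (hk2 : k < 2) (hq : 2 ≤ q) (hM : 0 < M) (hB : 0 < B)
    (hR : Real.sqrt 2 + 1 < R)
    (f : (Fin d → ℝ) → ℝ) (hmeas : Measurable f)
    (hf : ∀ x, |f x| ≤ B * Real.exp (M * euclNorm x ^ k)) :
    ∫ x, |f x - f (fun i => smoothProj R (x i))| ^ q ∂(stdGaussian d) ≤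
      (2 ^ q * (π / 2) ^ ((d : ℝ) / 2 - 1) * B ^ q *
          Real.exp (((2 - k) / 2) * q * M * (2 * q * k * M) ^ (k / (2 - k))) *
          (doubleFactorial (d + 1) : ℝ)) *
        (R - 1) ^ ((d : ℝ) - 2) * Real.exp (-(R - 1) ^ 2 / 4) := by
  obtain ⟨n, rfl⟩ : ∃ n, d = n + 1 := ⟨d - 1, by omega⟩
  have hr : √2 < R - 1 := by linarith
  have hr0 : 0 ≤ R - 1 := (Real.sqrt_nonneg 2).trans hr.le
  set A := 2 ^ q * B ^ q *
    Real.exp (((2 - k) / 2) * q * M * (2 * q * k * M) ^ (k / (2 - k))) with hA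
  have hA0 : 0 ≤ A := by positivity
  have hmeasPDF : Measurable fun x : Fin (n + 1) → ℝ =>
      ENNReal.ofReal (∏ i, gaussianPDFReal 0 1 (x i)) :=
    (Finset.measurable_prod _ fun i _ =>
      (measurable_gaussianPDFReal 0 1).comp (measurable_pi_apply i)).ennreal_ofReal
  rw [pi_gaussianReal_eq_withDensity, integral_withDensity_eq_integral_toReal_smul hmeasPDF
    (ae_of_all _ fun _ => ENNReal.ofReal_lt_top)]
  have hS : 0 < √(2 * π) := by positivity
  calc _ ≤ ∫ x : Fin (n + 1) → ℝ,
        (√(2 * π))⁻¹ ^ (n + 1) * A * tailWeight (R - 1) (euclNorm x) := by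
        refine integral_mono_of_nonneg (ae_of_all _ fun x => ?_)
          ((integrable_tailWeight_euclNorm _ n).const_mul _) (ae_of_all _ fun x => ?_)
        · exact smul_nonneg ENNReal.toReal_nonneg (Real.rpow_nonneg (abs_nonneg _) _)
        · have h := abs_sub_comp_smoothProj_rpow_le hk0 hk2 (by linarith : 0 < q) hM hB
            (by linarith : 1 ≤ R) hf x
          simp only [smul_eq_mul]
          rw [ENNReal.toReal_ofReal
            (Finset.prod_nonneg fun i _ => gaussianPDFReal_nonneg 0 1 (x i)),
            prod_gaussianPDFReal, mul_assoc, mul_assoc, mul_comm (Real.exp _)]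
          exact mul_le_mul_of_nonneg_left h (by positivity)
    _ = A * (gaussSurface n * gaussTail (R - 1) n) := by
        rw [integral_const_mul, integral_tailWeight_euclNorm hr0, inv_pow]
        field_simp
    _ ≤ A * (dimConst n * (R - 1) ^ (((n + 1 : ℕ) : ℝ) - 2) * Real.exp (-(R - 1) ^ 2 / 4)) :=
        mul_le_mul_of_nonneg_left (gaussSurface_mul_gaussTail_le hr n) hA0
    _ = _ := by
        rw [hA, dimConst]
        ring
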